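/- Let G = (V₁,E₁) be a connected graph with |V₁| ≥ 2 and H = (V₂,E₂) an arbitrary graph with |V₂| ≥ 1, with adjacency matrix A_H. If −2 − ψ_{H*}⁻¹(QEC(G)) < min ev(A_H), then QEC(G⊙H) = ψ_{H*}⁻¹(QEC(G)). -/

import Mathlib

open scoped BigOperators
open Filter Topology
open scoped Classical

namespace QECPaper

/-- The cone (join) `K₁ + H` over a graph `H`: vertex `none` is the apex. -/
def cone {V₂ : Type*} (H : SimpleGraph V₂) : SimpleGraph (Option V₂) where
  Adj x y := (∃ a b, x = some a ∧ y = some b ∧ H.Adj a b) ∨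
    (x = none ∧ y ≠ none) ∨ (x ≠ none ∧ y = none)
  symm := by
    refine ⟨?_⟩
    rintro x y (⟨a, b, rfl, rfl, h⟩ | ⟨rfl, hy⟩ | ⟨hx, rfl⟩)
    · exact Or.inl ⟨b, a, rfl, rfl, h.symm⟩
    · exact Or.inr (Or.inr ⟨hy, rfl⟩)
    · exact Or.inr (Or.inl ⟨rfl, hx⟩)
  loopless := by
    refine ⟨?_⟩
    rintro x (⟨a, b, rfl, hb, h⟩ | ⟨rfl, hy⟩ | ⟨hx, rfl⟩)
    · exact H.loopless.irrefl a (by cases hb; exact h)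
    · exact hy rfl
    · exact hx rfl

/-- The corona `G ⊙ H` of two graphs, realized on `V₁ × ({o} ∪ V₂)`
with `o = none`. -/
def corona {V₁ V₂ : Type*} (G : SimpleGraph V₁) (H : SimpleGraph V₂) :
    SimpleGraph (V₁ × Option V₂) where
  Adj p q := (p.1 = q.1 ∧ (cone H).Adj p.2 q.2) ∨
    (G.Adj p.1 q.1 ∧ p.2 = none ∧ q.2 = none)
  symm := by
    refine ⟨?_⟩
    rintro ⟨i, x⟩ ⟨j, y⟩ (⟨h1, h2⟩ | ⟨h1, h2, h3⟩)
    · exact Or.inl ⟨h1.symm, (cone H).symm.symm _ _ h2⟩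
    · exact Or.inr ⟨h1.symm, h3, h2⟩
  loopless := by
    refine ⟨?_⟩
    rintro ⟨i, x⟩ (⟨h1, h2⟩ | ⟨h1, h2, h3⟩)
    · exact (cone H).loopless.irrefl x h2
    · exact G.loopless.irrefl i h1

/-- The quadratic embedding constant of a (connected) graph on a finite vertex set. -/
noncomputable def QEC {V : Type*} [Fintype V] (G : SimpleGraph V) : ℝ :=
  sSup {r : ℝ | ∃ f : V → ℝ, (∑ x, f x ^ 2) = 1 ∧ (∑ x, f x) = 0 ∧
    r = ∑ x, ∑ y, f x * (G.dist x y : ℝ) * f y}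

/-- The set `λ(S)` of `λ` appearing in a solution of the basic equations. -/
def lambdaS {V : Type*} [Fintype V] (G : SimpleGraph V) : Set ℝ :=
  {lam : ℝ | ∃ (f : V → ℝ) (μ : ℝ),
    (∀ x, (∑ y, (G.dist x y : ℝ) * f y) - lam * f x = μ / 2) ∧
    (∑ x, f x) = 0 ∧ (∑ x, f x ^ 2) = 1}

/-- The distance matrix of a graph, with real entries. -/
noncomputable def distMatrix {V : Type*} (G : SimpleGraph V) : Matrix V V ℝ :=
  Matrix.of fun x y => (G.dist x y : ℝ)

section MatrixFunctions

variable {ι : Type*} [Fintype ι] [DecidableEq ι]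

/-- The eigenspace `ker (A - α)` inside `EuclideanSpace ℝ ι`. -/
noncomputable def eigSpace (A : Matrix ι ι ℝ) (α : ℝ) :
    Submodule ℝ (EuclideanSpace ℝ ι) :=
  LinearMap.ker (Matrix.toEuclideanLin A - α • LinearMap.id)

/-- The all-ones vector of `EuclideanSpace ℝ ι`. -/
noncomputable def onesE (ι : Type*) [Fintype ι] : EuclideanSpace ℝ ι :=
  (WithLp.equiv 2 (ι → ℝ)).symm (fun _ => 1)

/-- `‖E_α 𝟏‖²`, where `E_α` is the orthogonal projection of `EuclideanSpace ℝ ι`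
onto the eigenspace `ker (A - α)`. -/
noncomputable def projNormSq (A : Matrix ι ι ℝ) (α : ℝ) : ℝ :=
  ‖(Submodule.orthogonalProjection (eigSpace A α) (onesE ι) : EuclideanSpace ℝ ι)‖ ^ 2

/-- The set of (real) eigenvalues of a matrix. -/
def evSet (A : Matrix ι ι ℝ) : Set ℝ :=
  {α : ℝ | ∃ v : ι → ℝ, v ≠ 0 ∧ A.mulVec v = α • v}

/-- The set of main eigenvalues: those `α` with `E_α 𝟏 ≠ 0`. -/
def mainEv (A : Matrix ι ι ℝ) : Set ℝ := {α : ℝ | projNormSq A α ≠ 0}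

/-- `k_A = |ev_M(A) \ {-2}|`. -/
noncomputable def kA (A : Matrix ι ι ℝ) : ℕ := (mainEv A \ {(-2 : ℝ)}).ncard

/-- The ω-function associated with the symmetric matrix `A`. -/
noncomputable def omegaFun (A : Matrix ι ι ℝ) (lam : ℝ) : ℝ :=
  1 + projNormSq A (-2) +
    ∑ᶠ α ∈ mainEv A \ {(-2 : ℝ)}, lam / (α + 2 + lam) * projNormSq A α

/-- The (maximal) domain of the ω-function: the complement of its poles. -/
def omegaDomain (A : Matrix ι ι ℝ) : Set ℝ :=
  {lam : ℝ | ∀ α ∈ mainEv A \ {(-2 : ℝ)}, lam ≠ -α - 2}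

/-- The set of zeroes of the ω-function (on its domain). -/
def omegaZeros (A : Matrix ι ι ℝ) : Set ℝ :=
  {lam : ℝ | lam ∈ omegaDomain A ∧ omegaFun A lam = 0}

/-- `λ*`, the largest zero of the ω-function. -/
noncomputable def lamStar (A : Matrix ι ι ℝ) : ℝ := sSup (omegaZeros A)

/-- The ψ-function associated with `A`: `ψ_A(λ) = λ/ω_A(λ)` extended
analytically across the poles of `ω_A` by the value `0`. -/
noncomputable def psiFun (A : Matrix ι ι ℝ) (lam : ℝ) : ℝ :=
  if -lam - 2 ∈ mainEv A \ {(-2 : ℝ)} then 0 else lam / omegaFun A lam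

/-- The inverse of the rightmost branch `ψ_{A*} = ψ_A ↾ (λ*, +∞)`:
`ψ_{A*}⁻¹(y)` is the unique `λ > λ*` with `ψ_A(λ) = y`. -/
noncomputable def psiStarInv (A : Matrix ι ι ℝ) (y : ℝ) : ℝ :=
  sSup {lam : ℝ | lamStar A < lam ∧ psiFun A lam = y}

end MatrixFunctions

section OmegaAnalysis

variable {ι : Type*} [Fintype ι] [DecidableEq ι] {A : Matrix ι ι ℝ}

lemma projNormSq_nonneg (A : Matrix ι ι ℝ) (α : ℝ) : 0 ≤ projNormSq A α := sq_nonneg _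

lemma omegaFun_eq_sum (hfin : (mainEv A \ {(-2 : ℝ)}).Finite) (lam : ℝ) :
    omegaFun A lam = 1 + projNormSq A (-2) +
      ∑ α ∈ hfin.toFinset, lam / (α + 2 + lam) * projNormSq A α := by
  rw [omegaFun, finsum_mem_eq_finite_toFinset_sum _ hfin]

lemma omegaFun_pos_of_nonneg (hfin : (mainEv A \ {(-2 : ℝ)}).Finite) {lam : ℝ} (h0 : 0 ≤ lam)
    (hlam : ∀ α ∈ mainEv A \ {(-2 : ℝ)}, 0 < α + 2 + lam) : 0 < omegaFun A lam := by
  rw [omegaFun_eq_sum hfin]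
  have := projNormSq_nonneg A (-2)
  have : 0 ≤ ∑ α ∈ hfin.toFinset, lam / (α + 2 + lam) * projNormSq A α :=
    Finset.sum_nonneg fun α hα => mul_nonneg
      (div_nonneg h0 (hlam α (hfin.mem_toFinset.1 hα)).le) (projNormSq_nonneg A α)
  linarith

lemma psiFun_eq_div {lam : ℝ} (hlam : ∀ α ∈ mainEv A \ {(-2 : ℝ)}, 0 < α + 2 + lam) :
    psiFun A lam = lam / omegaFun A lam := by
  rw [psiFun, if_neg]
  intro h
  have := hlam _ h
  linarith

/-- The cross-multiplied form of strict monotonicity of `ψ_A` to the right of the poles. -/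
lemma mul_omegaFun_lt_mul_omegaFun (hfin : (mainEv A \ {(-2 : ℝ)}).Finite) {lam mu : ℝ}
    (hlt : lam < mu) (hlam : ∀ α ∈ mainEv A \ {(-2 : ℝ)}, 0 < α + 2 + lam)
    (hωlam : 0 < omegaFun A lam) (hωmu : 0 < omegaFun A mu) :
    lam * omegaFun A mu < mu * omegaFun A lam := by
  rcases lt_or_ge 0 (lam * mu) with hpos | hneg
  · rw [omegaFun_eq_sum hfin, omegaFun_eq_sum hfin]
    have hc := projNormSq_nonneg A (-2)
    have hsum : lam * ∑ α ∈ hfin.toFinset, mu / (α + 2 + mu) * projNormSq A α ≤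
        mu * ∑ α ∈ hfin.toFinset, lam / (α + 2 + lam) * projNormSq A α := by
      rw [Finset.mul_sum, Finset.mul_sum]
      refine Finset.sum_le_sum fun α hα => ?_
      have h1 := hlam α (hfin.mem_toFinset.1 hα)
      have h2 : 0 < α + 2 + mu := by linarith
      have h3 : lam * mu / (α + 2 + mu) ≤ lam * mu / (α + 2 + lam) :=
        div_le_div_of_nonneg_left hpos.le h1 (by linarith)
      calc lam * (mu / (α + 2 + mu) * projNormSq A α)
          = lam * mu / (α + 2 + mu) * projNormSq A α := by ring
        _ ≤ lam * mu / (α + 2 + lam) * projNormSq A α :=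
          mul_le_mul_of_nonneg_right h3 (projNormSq_nonneg A α)
        _ = mu * (lam / (α + 2 + lam) * projNormSq A α) := by ring
    nlinarith
  · have h1 : lam ≤ 0 := by
      by_contra! h
      nlinarith [mul_pos h (h.trans hlt)]
    have h2 : 0 ≤ mu := by
      by_contra! h
      nlinarith [mul_pos (neg_pos.2 h) (neg_pos.2 (hlt.trans h))]
    rcases h1.lt_or_eq with h | rfl
    · nlinarith [mul_pos (neg_pos.2 h) hωmu, mul_nonneg h2 hωlam.le]
    · simpa using mul_pos hlt hωlam

lemma eq_of_psiFun_eq (hfin : (mainEv A \ {(-2 : ℝ)}).Finite) {lam mu : ℝ}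
    (hlam : ∀ α ∈ mainEv A \ {(-2 : ℝ)}, 0 < α + 2 + lam)
    (hmu : ∀ α ∈ mainEv A \ {(-2 : ℝ)}, 0 < α + 2 + mu)
    (hωlam : 0 < omegaFun A lam) (hωmu : 0 < omegaFun A mu)
    (h : psiFun A lam = psiFun A mu) : lam = mu := by
  rw [psiFun_eq_div hlam, psiFun_eq_div hmu, div_eq_div_iff hωlam.ne' hωmu.ne'] at h
  rcases lt_trichotomy lam mu with hlt | heq | hlt
  · linarith [mul_omegaFun_lt_mul_omegaFun hfin hlt hlam hωlam hωmu]
  · exact heq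
  · linarith [mul_omegaFun_lt_mul_omegaFun hfin hlt hmu hωmu hωlam]

lemma continuousOn_omegaFun (hfin : (mainEv A \ {(-2 : ℝ)}).Finite) {s : Set ℝ}
    (hs : ∀ lam ∈ s, ∀ α ∈ mainEv A \ {(-2 : ℝ)}, 0 < α + 2 + lam) :
    ContinuousOn (omegaFun A) s := by
  rw [funext (omegaFun_eq_sum hfin)]
  refine continuousOn_const.add (continuousOn_finsetSum _ fun α hα => ?_)
  refine ContinuousOn.mul (ContinuousOn.div continuousOn_id (by fun_prop) ?_) continuousOn_const
  exact fun lam hlam => (hs lam hlam α (hfin.mem_toFinset.1 hα)).ne'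

lemma omegaFun_lt_omegaFun (hfin : (mainEv A \ {(-2 : ℝ)}).Finite)
    (hne : (mainEv A \ {(-2 : ℝ)}).Nonempty) (hA : ∀ α ∈ mainEv A \ {(-2 : ℝ)}, 0 < α + 2)
    {lam mu : ℝ} (hlt : lam < mu) (hlam : ∀ α ∈ mainEv A \ {(-2 : ℝ)}, 0 < α + 2 + lam) :
    omegaFun A lam < omegaFun A mu := by
  rw [omegaFun_eq_sum hfin, omegaFun_eq_sum hfin]
  refine (add_lt_add_iff_left _).2
    (Finset.sum_lt_sum_of_nonempty (hfin.toFinset_nonempty.2 hne) fun α hα => ?_)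
  have hα' := hfin.mem_toFinset.1 hα
  have h1 := hlam α hα'
  have h2 := hA α hα'
  refine mul_lt_mul_of_pos_right ?_ ((projNormSq_nonneg A α).lt_of_ne' hα'.1)
  rw [div_lt_div_iff₀ h1 (by linarith)]
  nlinarith

lemma omegaFun_le_of_nonneg (hfin : (mainEv A \ {(-2 : ℝ)}).Finite)
    (hA : ∀ α ∈ mainEv A \ {(-2 : ℝ)}, 0 < α + 2) {lam : ℝ} (h0 : 0 ≤ lam) :
    omegaFun A lam ≤ 1 + projNormSq A (-2) + ∑ α ∈ hfin.toFinset, projNormSq A α := by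
  rw [omegaFun_eq_sum hfin]
  refine (add_le_add_iff_left _).2 (Finset.sum_le_sum fun α hα => ?_)
  have h2 := hA α (hfin.mem_toFinset.1 hα)
  refine mul_le_of_le_one_left (projNormSq_nonneg A α) ?_
  rw [div_le_one (by linarith)]
  linarith

/-- If all poles of `ω_A` are negative, then `ω_A` has a negative zero to their right. -/
lemma exists_omegaFun_eq_zero (hfin : (mainEv A \ {(-2 : ℝ)}).Finite)
    (hne : (mainEv A \ {(-2 : ℝ)}).Nonempty) (hA : ∀ α ∈ mainEv A \ {(-2 : ℝ)}, 0 < α + 2) :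
    ∃ z < 0, (∀ α ∈ mainEv A \ {(-2 : ℝ)}, 0 < α + 2 + z) ∧ omegaFun A z = 0 := by
  obtain ⟨m, hm, hle⟩ := Set.exists_min_image _ id hfin hne
  have hm2 := hA m hm
  have hcm : 0 < projNormSq A m := (projNormSq_nonneg A m).lt_of_ne' hm.1
  have hc0 := projNormSq_nonneg A (-2)
  set c := projNormSq A m with hc
  set d := 1 + projNormSq A (-2) with hd
  have hd0 : 0 < d := by linarith
  -- `ω_A` is nonpositive at the point `l`
  set l := -((m + 2) * d / (c + d)) with hl
  have hl0 : l < 0 := neg_neg_of_pos (by positivity)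
  have hml : m + 2 + l = (m + 2) * c / (c + d) := by
    rw [hl]; field_simp; ring
  have hpos : ∀ lam, l ≤ lam → ∀ α ∈ mainEv A \ {(-2 : ℝ)}, 0 < α + 2 + lam := by
    intro lam hlam α hα
    have h1 : m ≤ α := hle α hα
    have h2 : 0 < m + 2 + l := by rw [hml]; positivity
    linarith
  have hωl : omegaFun A l ≤ 0 := by
    rw [omegaFun_eq_sum hfin, ← Finset.add_sum_erase _ _ (hfin.mem_toFinset.2 hm)]
    have h1 : l / (m + 2 + l) * projNormSq A m = -d := by
      rw [hml, hl, ← hc]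
      field_simp
    have h2 : ∑ α ∈ hfin.toFinset.erase m, l / (α + 2 + l) * projNormSq A α ≤ 0 := by
      refine Finset.sum_nonpos fun α hα => mul_nonpos_of_nonpos_of_nonneg ?_
        (projNormSq_nonneg A α)
      exact div_nonpos_of_nonpos_of_nonneg hl0.le
        (hpos l le_rfl α (hfin.mem_toFinset.1 (Finset.mem_of_mem_erase hα))).le
    linarith
  have hω0 : 0 < omegaFun A 0 := omegaFun_pos_of_nonneg hfin le_rfl (hpos 0 hl0.le)
  obtain ⟨z, hz, hz0⟩ := intermediate_value_Icc hl0.le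
    (continuousOn_omegaFun hfin fun lam hlam => hpos lam hlam.1) ⟨hωl, hω0.le⟩
  refine ⟨z, hz.2.lt_of_ne ?_, hpos z hz.1, hz0⟩
  rintro rfl
  exact hω0.ne' hz0

lemma psiStarInv_spec_of_neg_poles (hfin : (mainEv A \ {(-2 : ℝ)}).Finite)
    (hne : (mainEv A \ {(-2 : ℝ)}).Nonempty) (hA : ∀ α ∈ mainEv A \ {(-2 : ℝ)}, 0 < α + 2)
    (y : ℝ) :
    0 < omegaFun A (psiStarInv A y) ∧ psiStarInv A y / omegaFun A (psiStarInv A y) = y := by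
  obtain ⟨z, hz0, hzpos, hωz⟩ := exists_omegaFun_eq_zero hfin hne hA
  have hpos : ∀ lam, z ≤ lam → ∀ α ∈ mainEv A \ {(-2 : ℝ)}, 0 < α + 2 + lam :=
    fun lam hlam α hα => by linarith [hzpos α hα]
  have hω : ∀ lam, z < lam → 0 < omegaFun A lam := fun lam hlam =>
    hωz ▸ omegaFun_lt_omegaFun hfin hne hA hlam hzpos
  have hstar : lamStar A = z := by
    refine IsGreatest.csSup_eq ⟨⟨fun α hα h => ?_, hωz⟩, fun lam hlam => ?_⟩
    · linarith [hzpos α hα]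
    · by_contra! h
      exact (hω lam h).ne' hlam.2
  -- a solution of `λ = y ω_A(λ)` to the right of `z`
  set C := 1 + projNormSq A (-2) + ∑ α ∈ hfin.toFinset, projNormSq A α with hC
  have hR0 : 0 ≤ |y| * C := mul_nonneg (abs_nonneg y) ((omegaFun_pos_of_nonneg hfin le_rfl
    (hpos 0 hz0.le)).le.trans (omegaFun_le_of_nonneg hfin hA le_rfl))
  have hcont : ContinuousOn (fun lam => lam - y * omegaFun A lam) (Set.Icc z (|y| * C)) :=
    continuousOn_id.sub (continuousOn_const.mul
      (continuousOn_omegaFun hfin fun lam hlam => hpos lam hlam.1))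
  have hRω : y * omegaFun A (|y| * C) ≤ |y| * C := by
    have h1 := hω _ (hz0.trans_le hR0)
    have h2 := omegaFun_le_of_nonneg hfin hA hR0
    exact (mul_le_mul_of_nonneg_right (le_abs_self y) h1.le).trans
      (mul_le_mul_of_nonneg_left h2 (abs_nonneg y))
  obtain ⟨l, hl, hl0⟩ := intermediate_value_Icc (hz0.le.trans hR0) hcont
    (show (0 : ℝ) ∈ Set.Icc _ _ from ⟨by simp [hωz, hz0.le], by simpa using hRω⟩)
  have hzl : z < l := by
    refine hl.1.lt_of_ne ?_
    rintro rfl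
    simp only [hωz, mul_zero, sub_zero] at hl0
    exact hz0.ne hl0
  have hψl : l / omegaFun A l = y := by
    rw [div_eq_iff (hω l hzl).ne']
    linarith
  have hinv : psiStarInv A y = l := by
    have : {lam : ℝ | lamStar A < lam ∧ psiFun A lam = y} = {l} := by
      ext lam
      simp only [Set.mem_ofPred_eq, Set.mem_singleton_iff, hstar]
      constructor
      · rintro ⟨h1, h2⟩
        refine eq_of_psiFun_eq hfin (hpos _ h1.le) (hpos _ hzl.le) (hω _ h1) (hω _ hzl) ?_
        rw [h2, psiFun_eq_div (hpos _ hzl.le), hψl]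
      · rintro rfl
        exact ⟨hzl, by rw [psiFun_eq_div (hpos _ hzl.le), hψl]⟩
    rw [psiStarInv, this, csSup_singleton]
  rw [hinv]
  exact ⟨hω l hzl, hψl⟩

/-- If `ψ_{A*}⁻¹(y)` lies to the right of all poles of `ω_A`, it solves `ψ_A(λ) = y`. -/
lemma psiStarInv_spec (hfin : (mainEv A \ {(-2 : ℝ)}).Finite)
    (hne : (mainEv A \ {(-2 : ℝ)}).Nonempty) {y : ℝ}
    (hpole : ∀ α ∈ mainEv A \ {(-2 : ℝ)}, 0 < α + 2 + psiStarInv A y) :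
    0 < omegaFun A (psiStarInv A y) ∧ psiStarInv A y / omegaFun A (psiStarInv A y) = y := by
  obtain ⟨m, hm, hle⟩ := Set.exists_min_image _ id hfin hne
  simp only [id] at hle
  rcases lt_or_gt_of_ne hm.2 with hm2 | hm2
  · have hpos : ∀ lam, -m - 2 < lam → ∀ α ∈ mainEv A \ {(-2 : ℝ)}, 0 < α + 2 + lam :=
      fun lam hlam α hα => by linarith [hle α hα]
    have hω : ∀ lam, -m - 2 < lam → 0 < omegaFun A lam := fun lam hlam =>
      omegaFun_pos_of_nonneg hfin (by linarith) (hpos lam hlam)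
    have hL : -m - 2 < psiStarInv A y := by linarith [hpole m hm]
    obtain ⟨l, hlS, hl⟩ :
        ∃ l ∈ {lam : ℝ | lamStar A < lam ∧ psiFun A lam = y}, -m - 2 < l := by
      by_contra! h
      exact hL.not_ge (Real.sSup_le h (by linarith))
    have hinv : psiStarInv A y = l := by
      refine IsGreatest.csSup_eq ⟨hlS, fun lam hlam => ?_⟩
      by_contra! h
      have h' := hl.trans h
      exact h.ne' (eq_of_psiFun_eq hfin (hpos _ h') (hpos _ hl) (hω _ h') (hω _ hl)
        (hlam.2.trans hlS.2.symm))
    rw [hinv, ← psiFun_eq_div (hpos l hl)]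
    exact ⟨hω l hl, hlS.2⟩
  · exact psiStarInv_spec_of_neg_poles hfin hne (fun α hα => by linarith [hle α hα]) y

end OmegaAnalysis

lemma quadForm_smul_add {ι : Type*} [Fintype ι] {A : Matrix ι ι ℝ}
    (hA : A.IsHermitian) {lam : ℝ} {w : ι → ℝ}
    (hw : ∀ x, A.mulVec w x + (2 + lam) * w x = 1) (k : ℝ) (v : ι → ℝ) :
    ∑ x, (k • w + v) x * (A.mulVec (k • w + v) x + (2 + lam) * (k • w + v) x) =
      k ^ 2 * ∑ x, w x + 2 * k * ∑ x, v x + ∑ x, v x * (A.mulVec v x + (2 + lam) * v x) := by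
  have hsymm : ∑ x, w x * A.mulVec v x = ∑ x, v x * A.mulVec w x := by
    have h1 : Matrix.vecMul w A = A.mulVec w := by
      rw [← Matrix.mulVec_transpose]
      exact congrArg (fun B => Matrix.mulVec B w) hA
    have h2 := Matrix.dotProduct_mulVec w A v
    rw [h1] at h2
    exact h2.trans (dotProduct_comm _ _)
  have hcross : ∑ x, w x * (A.mulVec v x + (2 + lam) * v x) = ∑ x, v x := by
    calc ∑ x, w x * (A.mulVec v x + (2 + lam) * v x)
        = ∑ x, w x * A.mulVec v x + ∑ x, (2 + lam) * (w x * v x) := by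
          rw [← Finset.sum_add_distrib]
          exact Finset.sum_congr rfl fun x _ => by ring
      _ = ∑ x, v x * (A.mulVec w x + (2 + lam) * w x) := by
          rw [hsymm, ← Finset.sum_add_distrib]
          exact Finset.sum_congr rfl fun x _ => by ring
      _ = ∑ x, v x := Finset.sum_congr rfl fun x _ => by rw [hw, mul_one]
  calc ∑ x, (k • w + v) x * (A.mulVec (k • w + v) x + (2 + lam) * (k • w + v) x)
      = ∑ x, (k ^ 2 * w x + k * v x + k * (w x * (A.mulVec v x + (2 + lam) * v x)) +
          v x * (A.mulVec v x + (2 + lam) * v x)) := by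
        refine Finset.sum_congr rfl fun x _ => ?_
        simp only [Matrix.mulVec_add, Matrix.mulVec_smul, Pi.add_apply, Pi.smul_apply, smul_eq_mul]
        linear_combination k * (k * w x + v x) * hw x
    _ = _ := by
        rw [Finset.sum_add_distrib, Finset.sum_add_distrib, Finset.sum_add_distrib,
          ← Finset.mul_sum, ← Finset.mul_sum, ← Finset.mul_sum, hcross]
        ring

section Spectral

variable {ι : Type*} [Fintype ι] [DecidableEq ι] {A : Matrix ι ι ℝ}

lemma mem_eigSpace_iff {α : ℝ} {v : EuclideanSpace ℝ ι} :
    v ∈ eigSpace A α ↔ A.mulVec v.ofLp = α • v.ofLp := by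
  rw [eigSpace, LinearMap.mem_ker, LinearMap.sub_apply, sub_eq_zero]
  exact (WithLp.ofLp_injective 2).eq_iff.symm

lemma eigSpace_eq_eigenspace (A : Matrix ι ι ℝ) (α : ℝ) :
    eigSpace A α = Module.End.eigenspace (Matrix.toEuclideanLin A) α := by
  ext v
  rw [Module.End.mem_eigenspace_iff, eigSpace, LinearMap.mem_ker, LinearMap.sub_apply,
    sub_eq_zero]
  rfl

lemma mem_evSet_iff_hasEigenvalue {α : ℝ} :
    α ∈ evSet A ↔ Module.End.HasEigenvalue (Matrix.toEuclideanLin A) α := by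
  rw [Module.End.HasEigenvalue, Module.End.HasUnifEigenvalue, ← Module.End.eigenspace,
    ← eigSpace_eq_eigenspace, Submodule.ne_bot_iff]
  constructor
  · rintro ⟨v, hv0, hv⟩
    exact ⟨WithLp.toLp 2 v, mem_eigSpace_iff.2 hv, fun h => hv0 (congrArg WithLp.ofLp h)⟩
  · rintro ⟨v, hv, hv0⟩
    exact ⟨v.ofLp, fun h => hv0 (WithLp.ofLp_injective 2 h), mem_eigSpace_iff.1 hv⟩

lemma evSet_finite (A : Matrix ι ι ℝ) : (evSet A).Finite :=
  (Module.End.finite_hasEigenvalue (Matrix.toEuclideanLin A)).subset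
    fun _ h => mem_evSet_iff_hasEigenvalue.1 h

lemma projNormSq_eq_zero_of_notMem_evSet {α : ℝ} (hα : α ∉ evSet A) : projNormSq A α = 0 := by
  have h : eigSpace A α = ⊥ := by
    rw [eigSpace_eq_eigenspace]
    by_contra h
    exact hα (mem_evSet_iff_hasEigenvalue.2 h)
  have h0 := ((eigSpace A α).orthogonalProjectionOnto (onesE ι)).2
  have h1 : ((eigSpace A α).orthogonalProjectionOnto (onesE ι) : EuclideanSpace ℝ ι) = 0 :=
    (Submodule.mem_bot ℝ).1 (h ▸ h0)
  exact pow_eq_zero_iff two_ne_zero |>.2 (norm_eq_zero.2 h1)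

lemma mainEv_subset_evSet (A : Matrix ι ι ℝ) : mainEv A ⊆ evSet A := fun _ hα => by
  by_contra h
  exact hα (projNormSq_eq_zero_of_notMem_evSet h)

lemma mainEv_diff_finite (A : Matrix ι ι ℝ) : (mainEv A \ {(-2 : ℝ)}).Finite :=
  (evSet_finite A).subset (Set.sdiff_subset.trans (mainEv_subset_evSet A))

lemma projNormSq_eq_inner (A : Matrix ι ι ℝ) (α : ℝ) :
    projNormSq A α = inner ℝ (onesE ι) ((eigSpace A α).starProjection (onesE ι)) := by
  rw [real_inner_comm]
  exact ((eigSpace A α).re_inner_starProjection_eq_normSq (onesE ι)).symm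

lemma sum_starProjection_eigSpace (hA : A.IsHermitian) (v : EuclideanSpace ℝ ι) :
    ∑ α ∈ (evSet_finite A).toFinset, (eigSpace A α).starProjection v = v := by
  have hT := Matrix.isSymmetric_toEuclideanLin_iff.2 hA
  have h := hT.orthogonalFamily_eigenspaces'.sum_projection_of_mem_iSup v (by
    rw [Submodule.orthogonal_eq_bot_iff.1 hT.orthogonalComplement_iSup_eigenspaces_eq_bot']
    trivial)
  conv_rhs => rw [← h]
  simp_rw [eigSpace_eq_eigenspace]
  refine (Finset.sum_subtype _ (fun α => ?_) _)
  rw [Set.Finite.mem_toFinset]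
  exact mem_evSet_iff_hasEigenvalue

/-- The resolvent at `-2 - λ` applied to the all-ones vector, and its relation to `ω_A(λ)`. -/
lemma exists_resolvent_ones (hA : A.IsHermitian) {lam : ℝ}
    (hlam : ∀ β ∈ evSet A, 0 < β + 2 + lam) :
    ∃ w : ι → ℝ, (∀ x, A.mulVec w x + (2 + lam) * w x = 1) ∧
      omegaFun A lam = 1 + lam * ∑ x, w x := by
  set F := (evSet_finite A).toFinset with hF
  have hmem : ∀ α ∈ F, α ∈ evSet A := fun α hα => (evSet_finite A).mem_toFinset.1 hα
  set P : ℝ → EuclideanSpace ℝ ι := fun α => (eigSpace A α).starProjection (onesE ι) with hP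
  have hsum : ∑ α ∈ F, P α = onesE ι := sum_starProjection_eigSpace hA _
  set w : EuclideanSpace ℝ ι := ∑ α ∈ F, (α + 2 + lam)⁻¹ • P α with hw
  have hMw : Matrix.toEuclideanLin A w + (2 + lam) • w = onesE ι := by
    rw [hw, map_sum, Finset.smul_sum, ← Finset.sum_add_distrib, ← hsum]
    refine Finset.sum_congr rfl fun α hα => ?_
    have hPα : Matrix.toEuclideanLin A (P α) = α • P α := by
      rw [← Module.End.mem_eigenspace_iff, ← eigSpace_eq_eigenspace]
      exact Submodule.starProjection_apply_mem _ _
    rw [map_smul, hPα, smul_smul, smul_smul, ← add_smul]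
    have := (hlam α (hmem α hα)).ne'
    rw [show (α + 2 + lam)⁻¹ * α + (2 + lam) * (α + 2 + lam)⁻¹ = 1 by field_simp; ring, one_smul]
  refine ⟨w.ofLp, fun x => ?_, ?_⟩
  · exact congrFun (congrArg WithLp.ofLp hMw) x
  have hs : ∑ x, w.ofLp x = ∑ α ∈ F, (α + 2 + lam)⁻¹ * projNormSq A α := by
    have h1 : ∑ x, w.ofLp x = inner ℝ (onesE ι) w := by
      simp [onesE, PiLp.inner_apply]
    rw [h1, hw, inner_sum]
    exact Finset.sum_congr rfl fun α _ => by
      rw [inner_smul_right, projNormSq_eq_inner]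
  have hfin := mainEv_diff_finite A
  have hF2 : ∑ α ∈ hfin.toFinset, lam / (α + 2 + lam) * projNormSq A α =
      ∑ α ∈ F.erase (-2), lam / (α + 2 + lam) * projNormSq A α := by
    refine Finset.sum_subset (fun α hα => ?_) fun α hα hα' => ?_
    · have hα := hfin.mem_toFinset.1 hα
      exact Finset.mem_erase.2 ⟨hα.2, (evSet_finite A).mem_toFinset.2 (mainEv_subset_evSet A hα.1)⟩
    · have : projNormSq A α = 0 := by
        by_contra h
        exact hα' (hfin.mem_toFinset.2 ⟨h, (Finset.mem_erase.1 hα).1⟩)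
      rw [this, mul_zero]
  rw [omegaFun_eq_sum hfin, hF2, hs, Finset.mul_sum, add_assoc]
  congr 1
  simp_rw [← mul_assoc, ← div_eq_mul_inv]
  by_cases h2 : (-2 : ℝ) ∈ F
  · rw [← Finset.add_sum_erase _ _ h2]
    have := hlam _ (hmem _ h2)
    have hlam0 : lam ≠ 0 := by linarith
    rw [neg_add_cancel, zero_add, div_self hlam0, one_mul]
  · rw [projNormSq_eq_zero_of_notMem_evSet fun h => h2 ((evSet_finite A).mem_toFinset.2 h),
      zero_add, Finset.erase_eq_of_notMem h2]

lemma quadForm_nonneg (hA : A.IsHermitian) {lam : ℝ} (hlam : ∀ β ∈ evSet A, 0 < β + 2 + lam)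
    (u : ι → ℝ) : 0 ≤ ∑ x, u x * (A.mulVec u x + (2 + lam) * u x) := by
  have hM : (A + (2 + lam) • (1 : Matrix ι ι ℝ)).IsHermitian :=
    hA.add (Matrix.isHermitian_one.smul (IsSelfAdjoint.all _))
  have hpsd : (A + (2 + lam) • (1 : Matrix ι ι ℝ)).PosSemidef := by
    rw [hM.posSemidef_iff_eigenvalues_nonneg]
    intro i
    have h := hM.mulVec_eigenvectorBasis i
    rw [Matrix.add_mulVec, Matrix.smul_mulVec, Matrix.one_mulVec, ← eq_sub_iff_add_eq,
      ← sub_smul] at h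
    have hmem : hM.eigenvalues i - (2 + lam) ∈ evSet A :=
      ⟨_, fun h0 => hM.eigenvectorBasis.orthonormal.ne_zero i (WithLp.ofLp_injective 2 h0), h⟩
    have := hlam _ hmem
    simp only [Pi.zero_apply]
    linarith
  have := hpsd.dotProduct_mulVec_nonneg u
  simpa [dotProduct, Matrix.add_mulVec, Matrix.smul_mulVec] using this

lemma mainEv_adjMatrix_diff_nonempty [Nonempty ι] (H : SimpleGraph ι) [DecidableRel H.Adj] :
    (mainEv (H.adjMatrix ℝ) \ {(-2 : ℝ)}).Nonempty := by
  by_contra hempty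
  have hzero : ∀ α, α ≠ -2 →
      (eigSpace (H.adjMatrix ℝ) α).starProjection (onesE ι) = 0 := fun α hα => by
    by_contra h
    exact hempty ⟨α, fun h0 => h (norm_eq_zero.1 (pow_eq_zero_iff two_ne_zero |>.1 h0)), hα⟩
  have hsum := sum_starProjection_eigSpace (SimpleGraph.isHermitian_adjMatrix ℝ H) (onesE ι)
  have hmem : onesE ι ∈ eigSpace (H.adjMatrix ℝ) (-2) := by
    rw [← hsum]
    refine Submodule.sum_mem _ fun α _ => ?_
    by_cases hα : α = -2
    · rw [hα]
      exact Submodule.starProjection_apply_mem _ _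
    · rw [hzero α hα]
      exact zero_mem _
  obtain ⟨x⟩ := ‹Nonempty ι›
  have h := congrFun (mem_eigSpace_iff.1 hmem) x
  rw [SimpleGraph.adjMatrix_mulVec_apply] at h
  simp [onesE] at h
  have : (0 : ℝ) ≤ H.degree x := by positivity
  linarith

/-- For fixed `g`, the form `λ (g - ⟨1, u⟩)² + ⟨u, (A + 2 + λ) u⟩` is minimized over `u` by
a multiple `g • t` of a fixed vector, with minimal value `ψ_A(λ) g²`. -/
lemma exists_minimizer (hA : A.IsHermitian) {lam : ℝ} (hlam : ∀ β ∈ evSet A, 0 < β + 2 + lam)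
    (hω : 0 < omegaFun A lam) :
    ∃ t : ι → ℝ, ∀ g : ℝ,
      lam * (g - ∑ x, (g • t) x) ^ 2 +
          ∑ x, (g • t) x * (A.mulVec (g • t) x + (2 + lam) * (g • t) x) =
        lam / omegaFun A lam * g ^ 2 ∧
      ∀ u : ι → ℝ, lam / omegaFun A lam * g ^ 2 ≤
        lam * (g - ∑ x, u x) ^ 2 + ∑ x, u x * (A.mulVec u x + (2 + lam) * u x) := by
  obtain ⟨w, hw, hωw⟩ := exists_resolvent_ones hA hlam
  set ω := omegaFun A lam with hωdef
  set s := ∑ x, w x with hs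
  have key : ∀ (g : ℝ) (v : ι → ℝ),
      lam * (g - ∑ x, ((g * (lam / ω)) • w + v) x) ^ 2 +
        ∑ x, ((g * (lam / ω)) • w + v) x * (A.mulVec ((g * (lam / ω)) • w + v) x +
          (2 + lam) * ((g * (lam / ω)) • w + v) x) =
      lam / ω * g ^ 2 +
        (lam * (∑ x, v x) ^ 2 + ∑ x, v x * (A.mulVec v x + (2 + lam) * v x)) := by
    intro g v
    have hsum : ∑ x, ((g * (lam / ω)) • w + v) x = g * (lam / ω) * s + ∑ x, v x := by
      simp only [Pi.add_apply, Pi.smul_apply, smul_eq_mul]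
      rw [Finset.sum_add_distrib, ← Finset.mul_sum]
    rw [quadForm_smul_add hA hw, hsum, ← hs]
    have hls : lam * s = ω - 1 := by linarith
    have h1 : g - g * (lam / ω) * s = g / ω := by
      field_simp
      linear_combination (-g) * hls
    have h2 : (lam / ω) ^ 2 * s = lam / ω - lam / ω ^ 2 := by
      field_simp
      linear_combination lam * hls
    rw [← sub_sub, h1]
    linear_combination g ^ 2 * h2
  refine ⟨(lam / ω) • w, fun g => ⟨?_, fun u => ?_⟩⟩
  · have h := key g 0
    simp only [add_zero] at h
    rw [smul_smul, h]
    simp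
  · have h := key g (u - (g * (lam / ω)) • w)
    rw [add_sub_cancel] at h
    rw [h]
    set v := u - (g * (lam / ω)) • w
    set t := ∑ x, v x with ht
    have hq := quadForm_nonneg hA hlam v
    have hq' := quadForm_nonneg hA hlam ((lam * t) • w + v)
    rw [quadForm_smul_add hA hw, ← ht, ← hs] at hq'
    set q := ∑ x, v x * (A.mulVec v x + (2 + lam) * v x)
    suffices 0 ≤ lam * t ^ 2 + q by linarith
    rcases le_or_gt 0 lam with h0 | h0
    · positivity
    · nlinarith [mul_nonneg (mul_nonneg (neg_nonneg.2 h0.le) (sq_nonneg t)) hω.le]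

end Spectral

section CoronaDistance

variable {V₁ V₂ : Type*} (G : SimpleGraph V₁) (H : SimpleGraph V₂)

/-- The graph distance of the cone `K₁ + H`, as an explicit function. -/
noncomputable def coneDist (x y : Option V₂) : ℕ :=
  if x = y then 0 else if (cone H).Adj x y then 1 else 2

/-- The distance to the apex of the cone. -/
def height (x : Option V₂) : ℕ := if x.isSome then 1 else 0

/-- The graph distance of the corona `G ⊙ H`, as an explicit function. -/
noncomputable def coronaDist (p q : V₁ × Option V₂) : ℕ :=
  if p.1 = q.1 then coneDist H p.2 q.2 else G.dist p.1 q.1 + height p.2 + height q.2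

variable {G H}

@[simp] lemma height_none : height (none : Option V₂) = 0 := rfl

@[simp] lemma height_some (a : V₂) : height (some a) = 1 := rfl

lemma height_le_one (x : Option V₂) : height x ≤ 1 := by
  cases x <;> simp

lemma cone_adj_none_some (a : V₂) : (cone H).Adj none (some a) :=
  Or.inr (Or.inl ⟨rfl, by simp⟩)

lemma cone_adj_some_some {a b : V₂} : (cone H).Adj (some a) (some b) ↔ H.Adj a b := by
  simp [cone]

lemma coneDist_none_left (y : Option V₂) : coneDist H none y = height y := by
  cases y with
  | none => simp [coneDist]
  | some a => simp [coneDist, cone_adj_none_some]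

lemma coneDist_le_of_adj {x x' : Option V₂} (h : (cone H).Adj x x') (y : Option V₂) :
    coneDist H x y ≤ coneDist H x' y + 1 := by
  unfold coneDist
  by_cases hx' : x' = y
  · subst hx'
    simp [h, h.ne]
  · rw [if_neg hx']
    split_ifs <;> omega

lemma coronaDist_le_of_adj (hG : G.Connected) {p p' : V₁ × Option V₂}
    (h : (corona G H).Adj p p') (q : V₁ × Option V₂) :
    coronaDist G H p q ≤ coronaDist G H p' q + 1 := by
  obtain ⟨i, x⟩ := p
  obtain ⟨i', x'⟩ := p'
  obtain ⟨j, y⟩ := q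
  rcases h with ⟨h1, h2⟩ | ⟨h1, h2, h3⟩
  · simp only at h1 h2
    subst h1
    by_cases hij : i = j
    · simpa [coronaDist, hij] using coneDist_le_of_adj h2 y
    · have := height_le_one x
      simp only [coronaDist, hij, if_false]
      omega
  · simp only at h1 h2 h3
    subst h2 h3
    have hd : G.dist i i' = 1 := SimpleGraph.dist_eq_one_iff_adj.2 h1
    have htri := hG.dist_triangle (u := i) (v := i') (w := j)
    by_cases hij : i = j
    · subst hij
      simp only [coronaDist, h1.ne', if_true, if_false, coneDist_none_left]
      omega
    · by_cases hij' : i' = j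
      · subst hij'
        simp only [coronaDist, hij, if_true, if_false, coneDist_none_left, height_none]
        omega
      · simp only [coronaDist, hij, hij', if_false]
        omega

lemma coronaDist_le_length (hG : G.Connected) {p q : V₁ × Option V₂}
    (W : (corona G H).Walk p q) : coronaDist G H p q ≤ W.length := by
  induction W with
  | nil => simp [coronaDist, coneDist]
  | cons h W ih =>
    rw [SimpleGraph.Walk.length_cons]
    exact (coronaDist_le_of_adj hG h _).trans (Nat.add_le_add_right ih 1)

/-- The embedding of `G` into `G ⊙ H` as the set of apexes. -/
def apexHom (G : SimpleGraph V₁) (H : SimpleGraph V₂) : G →g corona G H where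
  toFun i := (i, none)
  map_rel' h := Or.inr ⟨h, rfl, rfl⟩

lemma exists_walk_apex (i : V₁) (x : Option V₂) :
    ∃ W : (corona G H).Walk (i, x) (i, none), W.length = height x := by
  cases x with
  | none => exact ⟨.nil, rfl⟩
  | some a =>
    have h : (corona G H).Adj (i, some a) (i, none) := Or.inl ⟨rfl, (cone_adj_none_some a).symm⟩
    exact ⟨h.toWalk, rfl⟩

lemma exists_walk_through_apexes (hG : G.Connected) (p q : V₁ × Option V₂) :
    ∃ W : (corona G H).Walk p q, W.length = G.dist p.1 q.1 + height p.2 + height q.2 := by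
  obtain ⟨W₁, h₁⟩ := exists_walk_apex (G := G) (H := H) p.1 p.2
  obtain ⟨W₂, h₂⟩ := exists_walk_apex (G := G) (H := H) q.1 q.2
  obtain ⟨W, h⟩ := hG.exists_walk_length_eq_dist p.1 q.1
  obtain ⟨W₃, h₃⟩ :
      ∃ W₃ : (corona G H).Walk (p.1, none) (q.1, none), W₃.length = G.dist p.1 q.1 :=
    ⟨W.map (apexHom G H), (SimpleGraph.Walk.length_map _ _).trans h⟩
  refine ⟨(W₁.append W₃).append W₂.reverse, ?_⟩
  rw [SimpleGraph.Walk.length_append, SimpleGraph.Walk.length_append,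
    SimpleGraph.Walk.length_reverse, h₁, h₂, h₃]
  omega

lemma exists_walk_length_le_coronaDist (hG : G.Connected) (p q : V₁ × Option V₂) :
    ∃ W : (corona G H).Walk p q, W.length ≤ coronaDist G H p q := by
  obtain ⟨W, hW⟩ := exists_walk_through_apexes (H := H) hG p q
  by_cases h1 : p.1 = q.1
  · obtain ⟨i, x⟩ := p
    obtain ⟨j, y⟩ := q
    simp only at h1
    subst h1
    by_cases hxy : x = y
    · subst hxy
      exact ⟨.nil, Nat.zero_le _⟩
    · by_cases hadj : (cone H).Adj x y
      · have h : (corona G H).Adj (i, x) (i, y) := Or.inl ⟨rfl, hadj⟩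
        exact ⟨h.toWalk, by simp [coronaDist, coneDist, hxy, hadj]⟩
      · refine ⟨W, ?_⟩
        have hx := height_le_one x
        have hy := height_le_one y
        simp only [coronaDist, coneDist, hxy, hadj, if_true, if_false]
        rw [hW, SimpleGraph.dist_self]
        simp only
        omega
  · exact ⟨W, by simp [coronaDist, h1, hW]⟩

lemma dist_corona (hG : G.Connected) (p q : V₁ × Option V₂) :
    (corona G H).dist p q = coronaDist G H p q := by
  obtain ⟨W, hW⟩ := exists_walk_length_le_coronaDist (H := H) hG p q
  refine le_antisymm ((SimpleGraph.dist_le W).trans hW) ?_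
  obtain ⟨W', hW'⟩ := W.reachable.exists_walk_length_eq_dist
  exact hW' ▸ coronaDist_le_length hG W'

/-- The correction of the distance inside a fibre of the corona, i.e. `A_H + 2` on `V₂`. -/
noncomputable def fibreForm (H : SimpleGraph V₂) [DecidableEq V₂] [DecidableRel H.Adj] :
    Option V₂ → Option V₂ → ℝ
  | some a, some b => H.adjMatrix ℝ a b + if a = b then 2 else 0
  | _, _ => 0

lemma dist_corona_eq [DecidableEq V₂] [DecidableRel H.Adj] (hG : G.Connected)
    (i j : V₁) (x y : Option V₂) :
    ((corona G H).dist (i, x) (j, y) : ℝ) =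
      G.dist i j + height x + height y - if i = j then fibreForm H x y else 0 := by
  rw [dist_corona hG]
  by_cases hij : i = j
  · subst hij
    cases x <;> cases y
    · simp [coronaDist, fibreForm, coneDist]
    · simp [coronaDist, fibreForm, coneDist_none_left]
    · simp [coronaDist, fibreForm, coneDist, (cone_adj_none_some _).symm]
    · rename_i a b
      by_cases hab : a = b
      · subst hab
        simp [coronaDist, fibreForm, coneDist]
        norm_num
      · by_cases hadj : H.Adj a b
        · simp [coronaDist, fibreForm, coneDist, hab, hadj, cone_adj_some_some]
        · simp [coronaDist, fibreForm, coneDist, hab, hadj, cone_adj_some_some]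
          norm_num
  · simp [coronaDist, hij]

end CoronaDistance

section QuadraticForm

lemma isGreatest_QEC {V : Type*} [Fintype V] (G : SimpleGraph V) (hV : 2 ≤ Fintype.card V) :
    IsGreatest {r : ℝ | ∃ f : V → ℝ, (∑ x, f x ^ 2) = 1 ∧ (∑ x, f x) = 0 ∧
      r = ∑ x, ∑ y, f x * (G.dist x y : ℝ) * f y} (QEC G) := by
  set K : Set (V → ℝ) := {f | (∑ x, f x ^ 2) = 1 ∧ (∑ x, f x) = 0} with hK
  set Q : (V → ℝ) → ℝ := fun f => ∑ x, ∑ y, f x * (G.dist x y : ℝ) * f y with hQ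
  have himage : {r : ℝ | ∃ f : V → ℝ, (∑ x, f x ^ 2) = 1 ∧ (∑ x, f x) = 0 ∧
      r = ∑ x, ∑ y, f x * (G.dist x y : ℝ) * f y} = Q '' K := by
    ext r
    constructor
    · rintro ⟨f, h1, h2, rfl⟩
      exact ⟨f, ⟨h1, h2⟩, rfl⟩
    · rintro ⟨f, ⟨h1, h2⟩, rfl⟩
      exact ⟨f, h1, h2, rfl⟩
  have hclosed : IsClosed K :=
    (isClosed_eq (by fun_prop) continuous_const).inter (isClosed_eq (by fun_prop) continuous_const)
  have hbounded : Bornology.IsBounded K := by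
    refine (Metric.isBounded_closedBall (x := (0 : V → ℝ)) (r := 1)).subset fun f hf => ?_
    rw [mem_closedBall_zero_iff, pi_norm_le_iff_of_nonneg zero_le_one]
    intro x
    rw [Real.norm_eq_abs, ← sq_le_one_iff_abs_le_one, ← hf.1]
    exact Finset.single_le_sum (f := fun x => f x ^ 2) (fun _ _ => sq_nonneg _) (Finset.mem_univ x)
  have hne : K.Nonempty := by
    obtain ⟨a, b, hab⟩ := Fintype.one_lt_card_iff.1 hV
    have hs : (√2)⁻¹ ^ 2 = (2 : ℝ)⁻¹ := by
      rw [inv_pow, Real.sq_sqrt zero_le_two]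
    refine ⟨Pi.single a (√2)⁻¹ - Pi.single b (√2)⁻¹, ?_, ?_⟩
    · have : ∀ x, (Pi.single a (√2)⁻¹ - Pi.single b (√2)⁻¹ : V → ℝ) x ^ 2 =
          (Pi.single a (2 : ℝ)⁻¹ : V → ℝ) x + (Pi.single b (2 : ℝ)⁻¹ : V → ℝ) x := by
        intro x
        by_cases ha : x = a
        · subst ha
          simp [hab, hs]
        · by_cases hb : x = b
          · subst hb
            simp [hab.symm, hs]
          · simp [ha, hb]
      rw [Finset.sum_congr rfl fun x _ => this x, Finset.sum_add_distrib]
      simp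
      norm_num
    · simp
  have hQcont : Continuous Q := by fun_prop
  have hcompact := (Metric.isCompact_of_isClosed_isBounded hclosed hbounded).image hQcont
  rw [QEC, himage]
  exact hcompact.isGreatest_sSup (hne.image Q)

lemma distForm_le_QEC_mul {V : Type*} [Fintype V] (G : SimpleGraph V) (hV : 2 ≤ Fintype.card V)
    (g : V → ℝ) (hg : ∑ x, g x = 0) :
    ∑ x, ∑ y, g x * (G.dist x y : ℝ) * g y ≤ QEC G * ∑ x, g x ^ 2 := by
  rcases (Finset.sum_nonneg fun x (_ : x ∈ Finset.univ) => sq_nonneg (g x)).eq_or_lt with h0 | h0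
  · have : ∀ x, g x = 0 := fun x => by
      have := (Finset.sum_eq_zero_iff_of_nonneg fun x _ => sq_nonneg (g x)).1 h0.symm x
        (Finset.mem_univ x)
      exact pow_eq_zero_iff two_ne_zero |>.1 this
    simp [this]
  · set n := ∑ x, g x ^ 2 with hn
    have hs : (√n)⁻¹ ^ 2 = n⁻¹ := by rw [inv_pow, Real.sq_sqrt h0.le]
    have h := (isGreatest_QEC G hV).2 ⟨fun x => (√n)⁻¹ * g x, by
      simp_rw [mul_pow]
      rw [← Finset.mul_sum, hs, ← hn, inv_mul_cancel₀ h0.ne'], by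
      rw [← Finset.mul_sum, hg, mul_zero], rfl⟩
    have heq : ∑ x, ∑ y, (√n)⁻¹ * g x * (G.dist x y : ℝ) * ((√n)⁻¹ * g y) =
        n⁻¹ * ∑ x, ∑ y, g x * (G.dist x y : ℝ) * g y := by
      simp_rw [Finset.mul_sum]
      refine Finset.sum_congr rfl fun x _ => Finset.sum_congr rfl fun y _ => ?_
      rw [← hs]
      ring
    rw [heq, inv_mul_le_iff₀ h0] at h
    linarith

lemma sum_sq_add_fibreForm {V₁ V₂ : Type*} [Fintype V₁] [Fintype V₂]
    {H : SimpleGraph V₂} [DecidableRel H.Adj] (lam : ℝ) (f : V₁ × Option V₂ → ℝ) :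
    ∑ i, (lam * (∑ x, f (i, x) - ∑ a, f (i, some a)) ^ 2 + ∑ a, f (i, some a) *
        ((H.adjMatrix ℝ).mulVec (fun b => f (i, some b)) a + (2 + lam) * f (i, some a))) =
      lam * ∑ p, f p ^ 2 + ∑ i, ∑ a, f (i, some a) *
        ((H.adjMatrix ℝ).mulVec (fun b => f (i, some b)) a + 2 * f (i, some a)) := by
  rw [Fintype.sum_prod_type, Finset.mul_sum, ← Finset.sum_add_distrib]
  refine Finset.sum_congr rfl fun i _ => ?_
  simp only [Fintype.sum_option, add_sub_cancel_right]
  rw [mul_add, Finset.mul_sum, add_assoc, ← Finset.sum_add_distrib]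
  congr 1
  exact Finset.sum_congr rfl fun a _ => by ring

variable {V₁ V₂ : Type*} [Fintype V₁] [Fintype V₂] [DecidableEq V₂]
  {G : SimpleGraph V₁} {H : SimpleGraph V₂} [DecidableRel H.Adj]

lemma sum_fibreForm (u : Option V₂ → ℝ) :
    ∑ x, ∑ y, u x * fibreForm H x y * u y =
      ∑ a, u (some a) * ((H.adjMatrix ℝ).mulVec (fun b => u (some b)) a + 2 * u (some a)) := by
  simp only [Fintype.sum_option, fibreForm, mul_zero, zero_mul, Finset.sum_const_zero, zero_add]
  refine Finset.sum_congr rfl fun a _ => ?_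
  calc ∑ b, u (some a) * (H.adjMatrix ℝ a b + if a = b then 2 else 0) * u (some b)
      = u (some a) * (∑ b, H.adjMatrix ℝ a b * u (some b) +
          ∑ b, (if a = b then 2 else 0) * u (some b)) := by
        rw [← Finset.sum_add_distrib, Finset.mul_sum]
        exact Finset.sum_congr rfl fun b _ => by ring
    _ = _ := by simp [Matrix.mulVec, dotProduct]

lemma distForm_corona (hG : G.Connected) (f : V₁ × Option V₂ → ℝ) (hf : ∑ p, f p = 0) :
    ∑ p, ∑ q, f p * ((corona G H).dist p q : ℝ) * f q =
      ∑ i, ∑ j, (∑ x, f (i, x)) * (G.dist i j : ℝ) * (∑ y, f (j, y)) -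
        ∑ i, ∑ a, f (i, some a) *
          ((H.adjMatrix ℝ).mulVec (fun b => f (i, some b)) a + 2 * f (i, some a)) := by
  have hterm : ∀ p q : V₁ × Option V₂, f p * ((corona G H).dist p q : ℝ) * f q =
      f p * (G.dist p.1 q.1 : ℝ) * f q + f p * height p.2 * f q + f p * (height q.2 * f q) -
        f p * (if p.1 = q.1 then fibreForm H p.2 q.2 else 0) * f q := by
    rintro ⟨i, x⟩ ⟨j, y⟩
    rw [dist_corona_eq hG]
    ring
  simp_rw [hterm, Finset.sum_sub_distrib, Finset.sum_add_distrib, ← Finset.mul_sum,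
    ← Finset.sum_mul, hf]
  have h1 : ∑ p : V₁ × Option V₂, ∑ q : V₁ × Option V₂, f p * (G.dist p.1 q.1 : ℝ) * f q =
      ∑ i, ∑ j, (∑ x, f (i, x)) * (G.dist i j : ℝ) * (∑ y, f (j, y)) := by
    rw [Fintype.sum_prod_type]
    refine Finset.sum_congr rfl fun i _ => ?_
    simp_rw [Fintype.sum_prod_type]
    rw [Finset.sum_comm]
    refine Finset.sum_congr rfl fun j _ => ?_
    simp_rw [Finset.sum_mul, Finset.mul_sum]
  have h2 : ∑ p : V₁ × Option V₂, ∑ q : V₁ × Option V₂,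
      f p * (if p.1 = q.1 then fibreForm H p.2 q.2 else 0) * f q =
      ∑ i, ∑ a, f (i, some a) *
          ((H.adjMatrix ℝ).mulVec (fun b => f (i, some b)) a + 2 * f (i, some a)) := by
    rw [Fintype.sum_prod_type]
    refine Finset.sum_congr rfl fun i _ => ?_
    rw [← sum_fibreForm (H := H) fun x => f (i, x)]
    refine Finset.sum_congr rfl fun x _ => ?_
    rw [Fintype.sum_prod_type]
    rw [Finset.sum_eq_single i (fun j _ hj => by simp [hj.symm]) (by simp)]
    simp
  rw [h1, h2]
  ring

end QuadraticForm

/-- Main formula when `−2 − ψ_{H*}⁻¹(QEC(G)) < min ev(A_H)`. -/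
theorem qec_corona_formula_of_lt_minEv {V₁ V₂ : Type*} [Fintype V₁] [Fintype V₂]
    [DecidableEq V₂]
    (G : SimpleGraph V₁) (H : SimpleGraph V₂) [DecidableRel H.Adj]
    (hG : G.Connected) (hV₁ : 2 ≤ Fintype.card V₁) (hV₂ : 1 ≤ Fintype.card V₂)
    (hmin : ∀ β ∈ evSet (H.adjMatrix ℝ),
      -2 - psiStarInv (H.adjMatrix ℝ) (QEC G) < β) :
    QEC (corona G H) = psiStarInv (H.adjMatrix ℝ) (QEC G) := by
  have hcard : 2 ≤ Fintype.card (V₁ × Option V₂) := by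
    rw [Fintype.card_prod, Fintype.card_option]
    nlinarith
  have : Nonempty V₂ := Fintype.card_pos_iff.1 hV₂
  set A := H.adjMatrix ℝ with hAdef
  have hA : A.IsHermitian := SimpleGraph.isHermitian_adjMatrix ℝ H
  have hpos : ∀ β ∈ evSet A, 0 < β + 2 + psiStarInv A (QEC G) := fun β hβ => by
    linarith [hmin β hβ]
  obtain ⟨hω, hψ⟩ := psiStarInv_spec (mainEv_diff_finite A) (mainEv_adjMatrix_diff_nonempty H)
    fun α hα => hpos α (mainEv_subset_evSet A hα.1)
  set lam := psiStarInv A (QEC G)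
  obtain ⟨t, ht⟩ := exists_minimizer hA hpos hω
  rw [hψ] at ht
  refine le_antisymm ?_ ?_
  · obtain ⟨f, hf1, hf0, hQ⟩ := (isGreatest_QEC (corona G H) hcard).1
    have hg0 : ∑ i, ∑ x, f (i, x) = 0 := by rw [← Fintype.sum_prod_type, hf0]
    have h1 := distForm_le_QEC_mul G hV₁ (fun i => ∑ x, f (i, x)) hg0
    have h2 := Finset.sum_le_sum fun i (_ : i ∈ Finset.univ) =>
      (ht (∑ x, f (i, x))).2 fun a => f (i, some a)
    rw [sum_sq_add_fibreForm, hf1, ← Finset.mul_sum] at h2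
    rw [hQ, distForm_corona hG f hf0]
    linarith
  · obtain ⟨g, hg1, hg0, hQ⟩ := (isGreatest_QEC G hV₁).1
    set f : V₁ × Option V₂ → ℝ := fun p =>
      p.2.elim (g p.1 - ∑ a, (g p.1 • t) a) (g p.1 • t) with hf
    have hfibre : ∀ i, ∑ x, f (i, x) = g i := fun i => by
      simp [hf, Fintype.sum_option]
    have hf0 : ∑ p, f p = 0 := by
      rw [Fintype.sum_prod_type]
      simp_rw [hfibre, hg0]
    have h1 := distForm_le_QEC_mul (corona G H) hcard f hf0
    have h2 := Finset.sum_congr rfl fun i (_ : i ∈ Finset.univ) => (ht (g i)).1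
    have h3 := sum_sq_add_fibreForm (H := H) lam f
    simp_rw [hfibre] at h3
    rw [← Finset.mul_sum, hg1, mul_one] at h2
    rw [distForm_corona hG f hf0] at h1
    simp_rw [hfibre] at h1
    rw [← hQ] at h1
    have h4 := h3.symm.trans h2
    have hfpos : 0 < ∑ p, f p ^ 2 := by
      refine (Finset.sum_nonneg fun p _ => sq_nonneg (f p)).lt_of_ne' fun h => ?_
      have hfz : ∀ p, f p = 0 := fun p => pow_eq_zero_iff two_ne_zero |>.1
        ((Finset.sum_eq_zero_iff_of_nonneg fun p _ => sq_nonneg (f p)).1 h p (Finset.mem_univ p))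
      have hgz : ∀ i, g i = 0 := fun i => by
        rw [← hfibre i]
        exact Finset.sum_eq_zero fun x _ => hfz _
      simp [hgz] at hg1
    refine le_of_mul_le_mul_right ?_ hfpos
    linarith

end QECPaper
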